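/- Let X and Y be CAT(0) cube complexes with no extremal vertices, let f : ∂X → ∂Y be a Möbius bijection, and let x1, x2, x, y1, y2, y ∈ ∂X satisfy x1 op_x x2 and y1 op_y y2. Set m_x := m(x1,x2,x), m_y := m(y1,y2,y), m'_x := m(f(x1),f(x2),f(x)), m'_y := m(f(y1),f(y2),f(y)). Suppose that (x1,x2,u,v) ∈ 𝒜(X) and (x1,x2,x,u) ∈ 𝒜(X) whenever u and v are distinct elements of {y1,y2,y}. Then d(m_x, m_y) = d(m'_x, m'_y); in particular, m'_x = m'_y if and only if m_x = m_y. -/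

import Mathlib

/-!
We use the standard combinatorial model of a CAT(0) cube complex: it is identified
with its vertex set endowed with the combinatorial (ℓ¹) metric, i.e. with a median
graph `G` on a vertex type `V`.  Halfspaces are realised as the vertex sets of the
two sides of the hyperplane dual to an edge, the Roller compactification `X̄` is the
set of ultrafilters of halfspaces, vertices embedding via principal ultrafilters,
and the Roller boundary `∂X` consists of the non-principal ultrafilters.
-/

open scoped ENNReal
open Set

namespace CCCR

variable {V V' : Type*}

/-- The interval between two vertices w.r.t. the combinatorial metric. -/
def vInterval (G : SimpleGraph V) (u v : V) : Set V :=
  {w : V | G.dist u w + G.dist w v = G.dist u v}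

/-- Combinatorial model of a CAT(0) cube complex (identified with its vertex set,
endowed with the combinatorial metric): a connected median graph. -/
def IsCCC (G : SimpleGraph V) : Prop :=
  G.Connected ∧ ∀ x y z : V, ∃! m : V,
    m ∈ vInterval G x y ∧ m ∈ vInterval G y z ∧ m ∈ vInterval G z x

/-- Halfspaces of the cube complex: the sides of the hyperplane dual to an edge. -/
def IsHalfspace (G : SimpleGraph V) (h : Set V) : Prop :=
  ∃ u v : V, G.Adj u v ∧ h = {w : V | G.dist w v < G.dist w u}

/-- The halfspace dual to the (oriented) edge `(u,v)` containing `v`. -/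
def edgeHalf (G : SimpleGraph V) (u v : V) : Set V :=
  {w : V | G.dist w v < G.dist w u}

/-- The hyperplane (wall) dual to the edge `(u,v)`, recorded as its pair of sides. -/
def wallOf (G : SimpleGraph V) (u v : V) : Set (Set V) :=
  {edgeHalf G u v, (edgeHalf G u v)ᶜ}

/-- Two (necessarily distinct) hyperplanes, with respective sides `h` and `k`,
are transverse: all four quarter-spaces are nonempty. -/
def Transv (h k : Set V) : Prop :=
  (h ∩ k).Nonempty ∧ (h ∩ kᶜ).Nonempty ∧ (hᶜ ∩ k).Nonempty ∧ (hᶜ ∩ kᶜ).Nonempty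

/-- An ultrafilter of halfspaces: a point of the Roller compactification X̄.
It contains exactly one side of each hyperplane, and any two members intersect. -/
def IsUltra (G : SimpleGraph V) (σ : Set (Set V)) : Prop :=
  (∀ h ∈ σ, IsHalfspace G h) ∧
  (∀ h : Set V, IsHalfspace G h → (h ∈ σ ↔ hᶜ ∉ σ)) ∧
  (∀ h ∈ σ, ∀ k ∈ σ, (h ∩ k).Nonempty)

/-- The principal ultrafilter of a vertex, i.e. the image of `v` in X̄. -/
def princ (G : SimpleGraph V) (v : V) : Set (Set V) :=
  {h : Set V | IsHalfspace G h ∧ v ∈ h}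

/-- A point of the Roller boundary ∂X = X̄ ∖ X: a non-principal ultrafilter. -/
def IsBdryPt (G : SimpleGraph V) (σ : Set (Set V)) : Prop :=
  IsUltra G σ ∧ ∀ v : V, σ ≠ princ G v

/-- The Roller boundary ∂X as a type. -/
abbrev Bdry (G : SimpleGraph V) : Type _ := {σ : Set (Set V) // IsBdryPt G σ}

/-- The Gromov product (x·y)_v = #𝒲(v | x, y) ∈ ℕ ∪ {+∞}, counted through the
sides containing both x and y but not v. -/
noncomputable def grom (_G : SimpleGraph V) (v : V) (x y : Set (Set V)) : ℕ∞ :=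
  {h : Set V | h ∈ x ∧ h ∈ y ∧ v ∉ h}.encard

/-- The embedding ℕ ∪ {+∞} → ℤ ∪ {±∞}. -/
noncomputable def toE (n : ℕ∞) : EReal := ((n : ℝ≥0∞) : EReal)

/-- The cross ratio cr_v(x,y,z,w) = (x·z)_v + (y·w)_v − (x·w)_v − (y·z)_v ∈ ℤ ∪ {±∞}. -/
noncomputable def crv (G : SimpleGraph V) (v : V) (x y z w : Set (Set V)) : EReal :=
  toE (grom G v x z) + toE (grom G v y w) - toE (grom G v x w) - toE (grom G v y z)

/-- The triple of sums of Gromov products attached to a 4-tuple. -/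
noncomputable def tripod (G : SimpleGraph V) (v : V) (x y z w : Set (Set V)) :
    ℕ∞ × ℕ∞ × ℕ∞ :=
  (grom G v x y + grom G v z w, grom G v x z + grom G v y w, grom G v x w + grom G v y z)

/-- (x,y,z,w) ∈ 𝒜 w.r.t. the basepoint v: at most one of the three sums is infinite. -/
def inA (G : SimpleGraph V) (v : V) (x y z w : Set (Set V)) : Prop :=
  ((tripod G v x y z w).1 ≠ ⊤ ∧ (tripod G v x y z w).2.1 ≠ ⊤) ∨
  ((tripod G v x y z w).1 ≠ ⊤ ∧ (tripod G v x y z w).2.2 ≠ ⊤) ∨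
  ((tripod G v x y z w).2.1 ≠ ⊤ ∧ (tripod G v x y z w).2.2 ≠ ⊤)

/-- (x,y,z,w) ∈ 𝒜 (this is independent of the basepoint). -/
def memA (G : SimpleGraph V) (x y z w : Set (Set V)) : Prop :=
  ∀ v : V, inA G v x y z w

/-- Two triples in (ℕ ∪ {+∞})³ are equivalent if they differ by adding a constant
n ∈ ℕ to all three entries. -/
def TripEquiv (p q : ℕ∞ × ℕ∞ × ℕ∞) : Prop :=
  (∃ n : ℕ, p.1 = q.1 + (n : ℕ∞) ∧ p.2.1 = q.2.1 + (n : ℕ∞) ∧ p.2.2 = q.2.2 + (n : ℕ∞)) ∨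
  (∃ n : ℕ, q.1 = p.1 + (n : ℕ∞) ∧ q.2.1 = p.2.1 + (n : ℕ∞) ∧ q.2.2 = p.2.2 + (n : ℕ∞))

/-- crt(x,y,z,w) = ⟪a:b:c⟫ (the cross ratio triple is independent of the basepoint,
so we require the equality of classes at every basepoint). -/
def crtEq (G : SimpleGraph V) (x y z w : Set (Set V)) (a b c : ℕ∞) : Prop :=
  ∀ v : V, TripEquiv (tripod G v x y z w) (a, b, c)

/-- The median of three points of X̄. -/
def med (x y z : Set (Set V)) : Set (Set V) := (x ∩ y) ∪ (y ∩ z) ∪ (z ∩ x)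

/-- The interval I(x,y) ⊆ X̄ between two points of X̄. -/
def rInterval (G : SimpleGraph V) (x y : Set (Set V)) : Set (Set (Set V)) :=
  {σ : Set (Set V) | IsUltra G σ ∧ x ∩ y ⊆ σ}

/-- `Op G x y z` : x and y are opposite with respect to z, i.e. the median
m = m(x,y,z) lies in X and I(x,y) = I(x,m) ∪ I(m,y). -/
def Op (G : SimpleGraph V) (x y z : Set (Set V)) : Prop :=
  (∃ p : V, med x y z = princ G p) ∧
  rInterval G x y = rInterval G x (med x y z) ∪ rInterval G (med x y z) y

/-- A geodesic ray (based at `r 0`). -/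
def IsGeodRay (G : SimpleGraph V) (r : ℕ → V) : Prop :=
  (∀ n : ℕ, G.Adj (r n) (r (n + 1))) ∧
  ∀ m n : ℕ, m ≤ n → G.dist (r m) (r n) = n - m

/-- A bi-infinite geodesic line. -/
def IsGeodLine (G : SimpleGraph V) (L : ℤ → V) : Prop :=
  (∀ n : ℤ, G.Adj (L n) (L (n + 1))) ∧
  ∀ m n : ℤ, m ≤ n → (G.dist (L m) (L n) : ℤ) = n - m

/-- The set 𝒲(r) of hyperplanes crossed by (the edges of) a ray. -/
def rayWalls (G : SimpleGraph V) (r : ℕ → V) : Set (Set (Set V)) :=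
  {W : Set (Set V) | ∃ n : ℕ, W = wallOf G (r n) (r (n + 1))}

/-- A hyperplane is adjacent to `v` if it is dual to an edge incident to `v`. -/
def WallAdjTo (G : SimpleGraph V) (v : V) (W : Set (Set V)) : Prop :=
  ∃ u : V, G.Adj v u ∧ W = wallOf G v u

/-- A straight ray: no two of the hyperplanes it crosses are transverse. -/
def RayStraight (G : SimpleGraph V) (r : ℕ → V) : Prop :=
  ∀ m n : ℕ, ¬ Transv (edgeHalf G (r m) (r (m + 1))) (edgeHalf G (r n) (r (n + 1)))

/-- A straight line: no two of the hyperplanes it crosses are transverse. -/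
def LineStraight (G : SimpleGraph V) (L : ℤ → V) : Prop :=
  ∀ m n : ℤ, ¬ Transv (edgeHalf G (L m) (L (m + 1))) (edgeHalf G (L n) (L (n + 1)))

/-- The endpoint at infinity r⁺ ∈ ∂X of a ray: the ultrafilter of those halfspaces
containing all but finitely many of its vertices. -/
def rayEnd (G : SimpleGraph V) (r : ℕ → V) : Set (Set V) :=
  {h : Set V | IsHalfspace G h ∧ ∃ N : ℕ, ∀ n : ℕ, N ≤ n → r n ∈ h}

/-- A straight point of the Roller boundary: the endpoint at infinity of a straight ray. -/
def IsStraightPt (G : SimpleGraph V) (x : Set (Set V)) : Prop :=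
  ∃ r : ℕ → V, IsGeodRay G r ∧ RayStraight G r ∧ rayEnd G r = x

/-- x and y are the two endpoints at infinity of the line L. -/
def LineEnds (G : SimpleGraph V) (L : ℤ → V) (x y : Set (Set V)) : Prop :=
  rayEnd G (fun n : ℕ => L (n : ℤ)) = x ∧ rayEnd G (fun n : ℕ => L (-(n : ℤ))) = y

/-- The edges from `v` to `a` and from `v` to `b` span a square. -/
def SpansSquare (G : SimpleGraph V) (v a b : V) : Prop :=
  ∃ w : V, w ≠ v ∧ G.Adj a w ∧ G.Adj b w

/-- An extremal vertex: some edge at `v` spans a square with every other edge at `v`. -/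
def Extremal (G : SimpleGraph V) (v : V) : Prop :=
  ∃ a : V, G.Adj v a ∧ ∀ b : V, G.Adj v b → b ≠ a → SpansSquare G v a b

/-- The cube complex has no extremal vertices. -/
def NoExtremal (G : SimpleGraph V) : Prop := ∀ v : V, ¬ Extremal G v

/-- A skinny vertex: exactly two incident edges. -/
def Skinny (G : SimpleGraph V) (v : V) : Prop := {u : V | G.Adj v u}.encard = 2

/-- A skinny ray: a geodesic ray whose initial vertex has at least three incident
edges and all of whose other vertices are skinny. -/
def IsSkinnyRay (G : SimpleGraph V) (r : ℕ → V) : Prop :=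
  IsGeodRay G r ∧ 3 ≤ {u : V | G.Adj (r 0) u}.encard ∧ ∀ n : ℕ, 1 ≤ n → Skinny G (r n)

/-- (The vertex set of) a cube of the complex: a subset inducing a hypercube graph. -/
def IsCube (G : SimpleGraph V) (c : Set V) : Prop :=
  ∃ (n : ℕ) (e : c ≃ (Fin n → Bool)),
    ∀ a b : c, G.Adj (a : V) (b : V) ↔ ∃! i : Fin n, e a i ≠ e b i

/-- A maximal cube. -/
def IsMaxCube (G : SimpleGraph V) (c : Set V) : Prop :=
  IsCube G c ∧ ∀ c' : Set V, IsCube G c' → c ⊆ c' → c' = c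

/-- Completeness: there is no infinite ascending chain of cubes. -/
def CubeComplete (G : SimpleGraph V) : Prop :=
  ¬ ∃ c : ℕ → Set V, (∀ n : ℕ, IsCube G (c n)) ∧ ∀ n : ℕ, c n ⊂ c (n + 1)

/-- No free faces: no non-maximal cube is contained in a unique maximal cube. -/
def NoFreeFaces (G : SimpleGraph V) : Prop :=
  ∀ c : Set V, IsCube G c → ¬ IsMaxCube G c → ¬ ∃! m : Set V, IsMaxCube G m ∧ c ⊆ m

/-- #𝒲(x, z | y, w): the number of hyperplanes separating x and z from y and w,
counted through the sides containing x and z. -/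
noncomputable def sepCount (x z y w : Set (Set V)) : ℕ∞ :=
  {h : Set V | h ∈ x ∧ h ∈ z ∧ h ∉ y ∧ h ∉ w}.encard

/-- A Möbius map between Roller boundaries: it maps 𝒜(X) into 𝒜(Y) and preserves
cross ratios. -/
def Mobius (G : SimpleGraph V) (G' : SimpleGraph V') (f : Bdry G → Bdry G') : Prop :=
  ∀ x y z w : Bdry G, memA G x.1 y.1 z.1 w.1 →
    memA G' (f x).1 (f y).1 (f z).1 (f w).1 ∧
    ∀ (v : V) (v' : V'),
      crv G' v' (f x).1 (f y).1 (f z).1 (f w).1 = crv G v x.1 y.1 z.1 w.1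

/-- The induced action of a cubical isomorphism on X̄: an ultrafilter is mapped to
the set of images of its halfspaces. -/
def mapUltra (φ : V → V') (σ : Set (Set V)) : Set (Set V') :=
  (fun h : Set V => φ '' h) '' σ

/-- The standard cubulation of ℝ: vertex set ℤ, edges between consecutive integers. -/
def zline : SimpleGraph ℤ := SimpleGraph.fromRel (fun m n => n = m + 1)

end CCCR


namespace CCCR

section Geometry

variable {V : Type*} {G : SimpleGraph V}

theorem exists_toward (hc : G.Connected) {a b : V} (h : a ≠ b) :
    ∃ c, G.Adj a c ∧ G.dist a b = G.dist c b + 1 := by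
  obtain ⟨p, hp⟩ := hc.exists_walk_length_eq_dist a b
  cases p with
  | nil => exact absurd rfl h
  | cons hadj q =>
    rename_i c
    refine ⟨c, hadj, ?_⟩
    have h1 := SimpleGraph.dist_le q
    have h2 := hc.dist_triangle (u := a) (v := c) (w := b)
    have h3 := SimpleGraph.dist_eq_one_iff_adj.2 hadj
    simp only [SimpleGraph.Walk.length_cons] at hp
    omega

/-- distances to the ends of an edge differ by exactly one -/
theorem edge_dist (hG : IsCCC G) {u v : V} (h : G.Adj u v) (w : V) :
    G.dist w v = G.dist w u + 1 ∨ G.dist w u = G.dist w v + 1 := by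
  obtain ⟨hc, hm⟩ := hG
  obtain ⟨m, ⟨h1, h2, h3⟩, -⟩ := hm u v w
  simp only [vInterval, mem_ofPred_eq] at h1 h2 h3
  have huv := SimpleGraph.dist_eq_one_iff_adj.2 h
  have e1 : G.dist u m = G.dist m u := SimpleGraph.dist_comm
  have e2 : G.dist v m = G.dist m v := SimpleGraph.dist_comm
  have e3 : G.dist w m = G.dist m w := SimpleGraph.dist_comm
  have e4 : G.dist w u = G.dist u w := SimpleGraph.dist_comm
  have e5 : G.dist w v = G.dist v w := SimpleGraph.dist_comm
  omega

theorem mem_edgeHalf {u v w : V} : w ∈ edgeHalf G u v ↔ G.dist w v < G.dist w u := Iff.rfl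

theorem compl_edgeHalf (hG : IsCCC G) {u v : V} (h : G.Adj u v) :
    (edgeHalf G u v)ᶜ = edgeHalf G v u := by
  ext w
  have := edge_dist hG h w
  simp only [mem_compl_iff, mem_edgeHalf]
  omega

theorem right_mem_edgeHalf {u v : V} (h : G.Adj u v) : v ∈ edgeHalf G u v := by
  have := SimpleGraph.dist_eq_one_iff_adj.2 h
  rw [mem_edgeHalf, SimpleGraph.dist_self, SimpleGraph.dist_comm]; omega

theorem left_notMem_edgeHalf {u v : V} : u ∉ edgeHalf G u v := by
  rw [mem_edgeHalf, SimpleGraph.dist_self]; omega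

/-- opposite edges of a square have the same halfspace -/
theorem square_sub (hG : IsCCC G) {u v u' v' : V} (huv : G.Adj u v) (huu : G.Adj u u')
    (hvv : G.Adj v v') (huv' : G.Adj u' v') (h1 : u ≠ v') (h2 : v ≠ u') :
    edgeHalf G u v ⊆ edgeHalf G u' v' := by
  intro w hw
  by_contra hcon
  rw [mem_edgeHalf] at hw hcon
  have a1 := edge_dist hG huv w
  have a2 := edge_dist hG huu w
  have a3 := edge_dist hG hvv w
  have a4 := edge_dist hG huv' w
  have b1 : G.dist w u = G.dist w v + 1 := by omega
  have b2 : G.dist w v' = G.dist w v + 1 := by omega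
  have b3 : G.dist w u' = G.dist w v := by omega
  have d1 := SimpleGraph.dist_eq_one_iff_adj.2 huv
  have d2 := SimpleGraph.dist_eq_one_iff_adj.2 huu
  have d3 := SimpleGraph.dist_eq_one_iff_adj.2 hvv
  have d4 := SimpleGraph.dist_eq_one_iff_adj.2 huv'
  have t1 := hG.1.dist_triangle (u := u) (v := v) (w := v')
  have t2 := hG.1.pos_dist_of_ne h1
  have t3 : G.dist u v' ≠ 1 := by
    intro h
    have := edge_dist hG (SimpleGraph.dist_eq_one_iff_adj.1 h) w
    omega
  have t4 : G.dist u v' = 2 := by omega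
  obtain ⟨m, -, hm⟩ := hG.2 u v' w
  apply h2
  have c1 : G.dist v' w = G.dist w v' := SimpleGraph.dist_comm
  have c2 : G.dist v w = G.dist w v := SimpleGraph.dist_comm
  have c3 : G.dist v' v = G.dist v v' := SimpleGraph.dist_comm
  have c4 : G.dist v u = G.dist u v := SimpleGraph.dist_comm
  have c5 : G.dist u' w = G.dist w u' := SimpleGraph.dist_comm
  have c6 : G.dist v' u' = G.dist u' v' := SimpleGraph.dist_comm
  have c7 : G.dist u' u = G.dist u u' := SimpleGraph.dist_comm
  rw [hm v, hm u']
  · simp only [vInterval, mem_ofPred_eq]; omega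
  · simp only [vInterval, mem_ofPred_eq]; omega

theorem square_eq (hG : IsCCC G) {u v u' v' : V} (huv : G.Adj u v) (huu : G.Adj u u')
    (hvv : G.Adj v v') (huv' : G.Adj u' v') (h1 : u ≠ v') (h2 : v ≠ u') :
    edgeHalf G u v = edgeHalf G u' v' :=
  Subset.antisymm (square_sub hG huv huu hvv huv' h1 h2)
    (square_sub hG huv' huu.symm hvv.symm huv h2.symm h1.symm)

/-- a halfspace is determined by any edge crossing it -/
theorem edgeHalf_eq (hG : IsCCC G) (k : ℕ) : ∀ {u v p q : V}, G.dist u p = k → G.Adj u v →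
    G.Adj p q → p ∉ edgeHalf G u v → q ∈ edgeHalf G u v → edgeHalf G p q = edgeHalf G u v := by
  induction k with
  | zero =>
    intro u v p q hk huv hpq hp hq
    have := hG.1.dist_eq_zero_iff.1 hk
    subst this
    have hd := SimpleGraph.dist_eq_one_iff_adj.2 hpq
    rw [mem_edgeHalf, SimpleGraph.dist_comm (u := q) (v := u), hd] at hq
    have : q = v := hG.1.dist_eq_zero_iff.1 (by omega)
    rw [this]
  | succ k ih =>
    intro u v p q hk huv hpq hp hq
    have hne : u ≠ p := by
      intro h; subst h; simp at hk
    obtain ⟨u', huu, hu'⟩ := exists_toward hG.1 hne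
    rw [mem_edgeHalf] at hp hq
    have c1 : G.dist u p = G.dist p u := SimpleGraph.dist_comm
    have c2 : G.dist u' p = G.dist p u' := SimpleGraph.dist_comm
    have e1 := edge_dist hG huv p
    have e2 := edge_dist hG huv q
    have e3 := edge_dist hG huu q
    have e4 := edge_dist hG hpq u
    have e5 := edge_dist hG hpq v
    have e6 := edge_dist hG hpq u'
    have c3 : G.dist v p = G.dist p v := SimpleGraph.dist_comm
    have c4 : G.dist u q = G.dist q u := SimpleGraph.dist_comm
    have c5 : G.dist v q = G.dist q v := SimpleGraph.dist_comm
    have c6 : G.dist u' q = G.dist q u' := SimpleGraph.dist_comm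
    have f1 : G.dist q v = k + 1 := by omega
    have f2 : G.dist q u = k + 2 := by omega
    have f3 : G.dist q u' = k + 1 := by omega
    have d1 := SimpleGraph.dist_eq_one_iff_adj.2 huv
    have d2 := SimpleGraph.dist_eq_one_iff_adj.2 huu
    have t1 := hG.1.dist_triangle (u := u') (v := u) (w := v)
    have t2 := hG.1.dist_triangle (u := v) (v := u') (w := p)
    have c7 : G.dist u' u = G.dist u u' := SimpleGraph.dist_comm
    have c8 : G.dist u' v = G.dist v u' := SimpleGraph.dist_comm
    have f4 : G.dist u' v = 2 := by omega
    obtain ⟨v', ⟨m1, m2, m3⟩, -⟩ := hG.2 u' v q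
    simp only [vInterval, mem_ofPred_eq] at m1 m2 m3
    have c9 : G.dist v' v = G.dist v v' := SimpleGraph.dist_comm
    have c10 : G.dist v' u' = G.dist u' v' := SimpleGraph.dist_comm
    have c11 : G.dist v' q = G.dist q v' := SimpleGraph.dist_comm
    have g1 : G.dist u' v' = 1 := by omega
    have g2 : G.dist v v' = 1 := by omega
    have g3 : G.dist q v' = k := by omega
    have hsq := square_eq hG huv huu (SimpleGraph.dist_eq_one_iff_adj.1 g2)
      (SimpleGraph.dist_eq_one_iff_adj.1 g1) (by rintro rfl; omega)
      (by rintro rfl; simp at f4)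
    rw [hsq]
    refine ih (by omega) (SimpleGraph.dist_eq_one_iff_adj.1 g1) hpq ?_ ?_
    · rw [← hsq, mem_edgeHalf]; exact hp
    · rw [← hsq, mem_edgeHalf]; exact hq

theorem half_eq (hG : IsCCC G) {h : Set V} (hh : IsHalfspace G h) {p q : V} (hpq : G.Adj p q)
    (hp : p ∉ h) (hq : q ∈ h) : h = edgeHalf G p q := by
  obtain ⟨u, v, huv, rfl⟩ := hh
  exact (edgeHalf_eq hG _ rfl huv hpq hp hq).symm

theorem half_edge {u v : V} (h : G.Adj u v) : IsHalfspace G (edgeHalf G u v) := ⟨u, v, h, rfl⟩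

theorem half_compl (hG : IsCCC G) {h : Set V} (hh : IsHalfspace G h) : IsHalfspace G hᶜ := by
  obtain ⟨u, v, huv, rfl⟩ := hh
  have := compl_edgeHalf hG huv
  exact ⟨v, u, huv.symm, this⟩

theorem exists_cross (hc : G.Connected) (h : Set V) (n : ℕ) : ∀ {a c : V}, G.dist a c = n →
    a ∈ h → c ∉ h →
    ∃ q p, G.Adj q p ∧ q ∈ h ∧ p ∉ h ∧ G.dist a q + 1 + G.dist p c = G.dist a c := by
  induction n with
  | zero =>
    intro a c hn ha hcn
    have := hc.dist_eq_zero_iff.1 hn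
    subst this; exact absurd ha hcn
  | succ n ih =>
    intro a c hn ha hcn
    have hne : a ≠ c := by rintro rfl; exact hcn ha
    obtain ⟨a', haa, hd⟩ := exists_toward hc hne
    by_cases h' : a' ∈ h
    · obtain ⟨q, p, h1, h2, h3, h4⟩ := ih (a := a') (c := c) (by omega) h' hcn
      refine ⟨q, p, h1, h2, h3, ?_⟩
      have t1 := hc.dist_triangle (u := a) (v := a') (w := q)
      have t2 := hc.dist_triangle (u := a) (v := q) (w := c)
      have t3 := hc.dist_triangle (u := q) (v := p) (w := c)
      have d1 := SimpleGraph.dist_eq_one_iff_adj.2 haa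
      have d2 := SimpleGraph.dist_eq_one_iff_adj.2 h1
      omega
    · refine ⟨a, a', haa, ha, h', ?_⟩
      rw [SimpleGraph.dist_self]; omega

theorem half_convex (hG : IsCCC G) {h : Set V} (hh : IsHalfspace G h) {a b c : V}
    (ha : a ∈ h) (hb : b ∈ h) (hc : G.dist a c + G.dist c b = G.dist a b) : c ∈ h := by
  by_contra hcn
  obtain ⟨q, p, h1, h2, h3, h4⟩ := exists_cross hG.1 h _ rfl ha hcn
  have he := half_eq hG hh h1.symm h3 h2
  rw [he, mem_edgeHalf] at hb
  have t1 := hG.1.dist_triangle (u := p) (v := c) (w := b)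
  have t2 := hG.1.dist_triangle (u := a) (v := q) (w := b)
  have c1 : G.dist b q = G.dist q b := SimpleGraph.dist_comm
  have c2 : G.dist b p = G.dist p b := SimpleGraph.dist_comm
  omega

/-- every halfspace not containing `m` is contained in a halfspace adjacent to `m` -/
theorem exists_adjacent (hG : IsCCC G) {h : Set V} (hh : IsHalfspace G h) {m : V} (hm : m ∉ h) :
    ∃ a, G.Adj m a ∧ h ⊆ edgeHalf G m a := by
  classical
  have hne : ∃ n, ∃ g ∈ h, G.dist m g = n := by
    obtain ⟨u, v, huv, rfl⟩ := hh
    exact ⟨_, v, right_mem_edgeHalf huv, rfl⟩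
  obtain ⟨g, hg, hgn⟩ := Nat.find_spec hne
  have hmin : ∀ c ∈ h, G.dist m g ≤ G.dist m c := by
    intro c hc
    rw [hgn]
    exact Nat.find_min' hne ⟨c, hc, rfl⟩
  have hmg : m ≠ g := by rintro rfl; exact hm hg
  obtain ⟨a, hma, hd⟩ := exists_toward hG.1 hmg
  refine ⟨a, hma, fun w hw => ?_⟩
  obtain ⟨c, ⟨m1, m2, m3⟩, -⟩ := hG.2 m g w
  simp only [vInterval, mem_ofPred_eq] at m1 m2 m3
  have hch : c ∈ h := half_convex hG hh hg hw m2
  have := hmin c hch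
  have hcg : c = g := hG.1.dist_eq_zero_iff.1 (by omega)
  subst hcg
  rw [mem_edgeHalf]
  have t := hG.1.dist_triangle (u := w) (v := c) (w := a)
  have c1 : G.dist c a = G.dist a c := SimpleGraph.dist_comm
  have c2 : G.dist c m = G.dist m c := SimpleGraph.dist_comm
  omega

/-- intersecting adjacent halfspaces span a square -/
theorem exists_square (hG : IsCCC G) {m a b : V} (ha : G.Adj m a) (hb : G.Adj m b) (hab : a ≠ b)
    (hi : (edgeHalf G m a ∩ edgeHalf G m b).Nonempty) :
    ∃ c, c ≠ m ∧ G.Adj a c ∧ G.Adj b c := by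
  obtain ⟨w, hwa, hwb⟩ := hi
  rw [mem_edgeHalf] at hwa hwb
  have e1 := edge_dist hG ha w
  have e2 := edge_dist hG hb w
  have d1 := SimpleGraph.dist_eq_one_iff_adj.2 ha
  have d2 := SimpleGraph.dist_eq_one_iff_adj.2 hb
  have t1 := hG.1.dist_triangle (u := a) (v := m) (w := b)
  have t2 := hG.1.pos_dist_of_ne hab
  have c1 : G.dist a m = G.dist m a := SimpleGraph.dist_comm
  obtain ⟨c, ⟨m1, m2, m3⟩, -⟩ := hG.2 a b w
  simp only [vInterval, mem_ofPred_eq] at m1 m2 m3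
  have c2 : G.dist c b = G.dist b c := SimpleGraph.dist_comm
  have c3 : G.dist c a = G.dist a c := SimpleGraph.dist_comm
  have c4 : G.dist b w = G.dist w b := SimpleGraph.dist_comm
  have c5 : G.dist c w = G.dist w c := SimpleGraph.dist_comm
  have g1 : G.dist a c = 1 := by omega
  have g2 : G.dist b c = 1 := by omega
  refine ⟨c, ?_, SimpleGraph.dist_eq_one_iff_adj.1 g1, SimpleGraph.dist_eq_one_iff_adj.1 g2⟩
  rintro rfl
  omega

/-- the distance counts separating halfspaces -/
theorem encard_sep (hG : IsCCC G) (n : ℕ) : ∀ {p q : V}, G.dist p q = n →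
    {h : Set V | IsHalfspace G h ∧ q ∈ h ∧ p ∉ h}.encard = (n : ℕ∞) := by
  induction n with
  | zero =>
    intro p q hn
    have := hG.1.dist_eq_zero_iff.1 hn
    subst this
    simp only [Nat.cast_zero, encard_eq_zero]
    ext h; simp
  | succ n ih =>
    intro p q hn
    have hne : p ≠ q := by rintro rfl; simp at hn
    obtain ⟨p', hpp, hd⟩ := exists_toward hG.1 hne
    have c1 : G.dist p q = G.dist q p := SimpleGraph.dist_comm
    have c2 : G.dist p' q = G.dist q p' := SimpleGraph.dist_comm
    have heq : {h : Set V | IsHalfspace G h ∧ q ∈ h ∧ p ∉ h} =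
        insert (edgeHalf G p p') {h : Set V | IsHalfspace G h ∧ q ∈ h ∧ p' ∉ h} := by
      ext h
      simp only [mem_ofPred_eq, mem_insert_iff]
      constructor
      · rintro ⟨hh, hq, hp⟩
        by_cases hp' : p' ∈ h
        · exact Or.inl (half_eq hG hh hpp hp hp')
        · exact Or.inr ⟨hh, hq, hp'⟩
      · rintro (rfl | ⟨hh, hq, hp'⟩)
        · refine ⟨half_edge hpp, ?_, left_notMem_edgeHalf⟩
          rw [mem_edgeHalf]; omega
        · refine ⟨hh, hq, fun hp => hp' (half_convex hG hh hp hq ?_)⟩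
          rw [SimpleGraph.dist_eq_one_iff_adj.2 hpp]; omega
    rw [heq, encard_insert_of_notMem, ih (p := p') (q := q) (by omega)]
    · push_cast; rfl
    · rintro ⟨-, -, h⟩
      exact h (right_mem_edgeHalf hpp)

theorem finite_sep (hG : IsCCC G) (p q : V) :
    {h : Set V | IsHalfspace G h ∧ q ∈ h ∧ p ∉ h}.Finite := by
  rw [← encard_ne_top_iff, encard_sep hG _ rfl]
  exact ENat.natCast_ne_top _

end Geometry

section Ultra

variable {V : Type*} {G : SimpleGraph V}

theorem ultra_up {σ : Set (Set V)} (hσ : IsUltra G σ) {h k : Set V} (hh : h ∈ σ)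
    (hk : IsHalfspace G k) (hsub : h ⊆ k) : k ∈ σ := by
  by_contra hn
  have h2 := (hσ.2.1 k hk)
  have h3 : kᶜ ∈ σ := by
    by_contra h4; exact hn (h2.2 h4)
  obtain ⟨w, hw1, hw2⟩ := hσ.2.2 h hh _ h3
  exact hw2 (hsub hw1)

theorem ultra_compl {σ : Set (Set V)} (hσ : IsUltra G σ) {h : Set V}
    (hh : IsHalfspace G h) (hn : h ∉ σ) : hᶜ ∈ σ := by
  by_contra h4; exact hn ((hσ.2.1 h hh).2 h4)

theorem ultra_not {σ : Set (Set V)} (hσ : IsUltra G σ) {h : Set V}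
    (hh : hᶜ ∈ σ) (hn : h ∈ σ) : False := by
  obtain ⟨w, hw1, hw2⟩ := hσ.2.2 _ hn _ hh
  exact hw2 hw1

theorem princ_ultra (hG : IsCCC G) (v : V) : IsUltra G (princ G v) := by
  refine ⟨fun h hh => hh.1, fun h hh => ?_, fun h hh k hk => ⟨v, hh.2, hk.2⟩⟩
  constructor
  · intro h1 h2; exact h2.2 h1.2
  · intro h1
    refine ⟨hh, ?_⟩
    by_contra h2
    exact h1 ⟨half_compl hG hh, h2⟩

theorem med_ultra {x y z : Set (Set V)} (hx : IsUltra G x) (hy : IsUltra G y)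
    (hz : IsUltra G z) : IsUltra G (med x y z) := by
  refine ⟨?_, ?_, ?_⟩
  · rintro h ((⟨h1, h2⟩ | ⟨h1, h2⟩) | ⟨h1, h2⟩)
    exacts [hx.1 _ h1, hy.1 _ h1, hz.1 _ h1]
  · intro h hh
    have a := hx.2.1 h hh
    have b := hy.2.1 h hh
    have c := hz.2.1 h hh
    simp only [med, mem_union, mem_inter_iff]
    tauto
  · rintro h ((⟨h1, h2⟩ | ⟨h1, h2⟩) | ⟨h1, h2⟩) k ((⟨k1, k2⟩ | ⟨k1, k2⟩) | ⟨k1, k2⟩)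
    exacts [hx.2.2 _ h1 _ k1, hy.2.2 _ h2 _ k1, hx.2.2 _ h1 _ k2,
      hy.2.2 _ h1 _ k2, hy.2.2 _ h1 _ k1, hz.2.2 _ h2 _ k1,
      hx.2.2 _ h2 _ k1, hz.2.2 _ h1 _ k2, hx.2.2 _ h2 _ k2]

/-- an ultrafilter at finite distance from a vertex is principal -/
theorem principal_of_finite (hG : IsCCC G) {σ : Set (Set V)} (hσ : IsUltra G σ) (n : ℕ) :
    ∀ v : V, {h : Set V | h ∈ σ ∧ v ∉ h}.Finite → {h : Set V | h ∈ σ ∧ v ∉ h}.ncard = n →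
      ∃ p, σ = princ G p := by
  induction n using Nat.strong_induction_on with
  | _ n ih =>
    intro v hf hn
    by_cases he : ∃ h ∈ σ, v ∉ h
    · obtain ⟨h, hh, hv⟩ := he
      obtain ⟨a, hva, hsub⟩ := exists_adjacent hG (hσ.1 h hh) hv
      have hmem : edgeHalf G v a ∈ σ := ultra_up hσ hh (half_edge hva) hsub
      have hss : {h : Set V | h ∈ σ ∧ a ∉ h} ⊂ {h : Set V | h ∈ σ ∧ v ∉ h} := by
        rw [Set.ssubset_iff_of_subset]
        · exact ⟨_, ⟨hmem, left_notMem_edgeHalf⟩, fun h => h.2 (right_mem_edgeHalf hva)⟩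
        · rintro j ⟨hj, haj⟩
          refine ⟨hj, fun hvj => ?_⟩
          have := half_eq hG (half_compl hG (hσ.1 j hj)) hva (fun h => h hvj) haj
          rw [← this] at hmem
          exact ultra_not hσ hmem hj
      exact ih _ (hn ▸ Set.ncard_lt_ncard hss hf) a (hf.subset hss.subset) rfl
    · push Not at he
      refine ⟨v, ?_⟩
      ext h
      constructor
      · intro hh; exact ⟨hσ.1 h hh, he h hh⟩
      · rintro ⟨hh, hv⟩
        by_contra hn
        exact he _ (ultra_compl hσ hh hn) hv

theorem princ_inj (hG : IsCCC G) {p q : V} (h : princ G p = princ G q) : p = q := by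
  have h1 := encard_sep hG _ (rfl : G.dist p q = G.dist p q)
  have h2 : {h : Set V | IsHalfspace G h ∧ q ∈ h ∧ p ∉ h} = ∅ := by
    ext j
    simp only [mem_ofPred_eq, mem_empty_iff_false, iff_false]
    rintro ⟨hj, hq, hp⟩
    have : j ∈ princ G q := ⟨hj, hq⟩
    rw [← h] at this
    exact hp this.2
  rw [h2, encard_empty] at h1
  exact hG.1.dist_eq_zero_iff.1 (by exact_mod_cast h1.symm)

theorem grom_comm (v : V) (x y : Set (Set V)) : grom G v x y = grom G v y x := by
  unfold grom; congr 1; ext h; simp only [mem_ofPred_eq]; tauto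

theorem grom_base (hG : IsCCC G) {x y : Set (Set V)} (hx : IsUltra G x) {v : V} (w : V)
    (h : grom G v x y ≠ ⊤) : grom G w x y ≠ ⊤ := by
  unfold grom at *
  rw [encard_ne_top_iff] at *
  refine (h.union (finite_sep hG w v)).subset ?_
  rintro j ⟨h1, h2, h3⟩
  by_cases hv : v ∈ j
  · exact Or.inr ⟨hx.1 _ h1, hv, h3⟩
  · exact Or.inl ⟨h1, h2, hv⟩

theorem grom_self (hG : IsCCC G) {x : Set (Set V)} (hx : IsBdryPt G x) (v : V) :
    grom G v x x = ⊤ := by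
  unfold grom
  by_contra h
  rw [← ne_eq, encard_ne_top_iff] at h
  have h' : {h : Set V | h ∈ x ∧ v ∉ h}.Finite := by
    refine h.subset ?_
    rintro j ⟨h1, h2⟩; exact ⟨h1, h1, h2⟩
  obtain ⟨p, hp⟩ := principal_of_finite hG hx.1 _ v h' rfl
  exact hx.2 p hp

theorem grom_zero {x y : Set (Set V)} {v : V} :
    grom G v x y = 0 ↔ ∀ h ∈ x, h ∈ y → v ∈ h := by
  unfold grom
  rw [encard_eq_zero, Set.eq_empty_iff_forall_notMem]
  constructor
  · intro h j h1 h2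
    by_contra h3; exact h j ⟨h1, h2, h3⟩
  · rintro h j ⟨h1, h2, h3⟩
    exact h3 (h j h1 h2)

theorem med_princ_grom {x y z : Set (Set V)} {m : V} (h : med x y z = princ G m) :
    grom G m x y = 0 ∧ grom G m y z = 0 ∧ grom G m x z = 0 := by
  refine ⟨?_, ?_, ?_⟩ <;> rw [grom_zero] <;> intro j h1 h2
  · have : j ∈ med x y z := Or.inl (Or.inl ⟨h1, h2⟩)
    rw [h] at this; exact this.2
  · have : j ∈ med x y z := Or.inl (Or.inr ⟨h1, h2⟩)
    rw [h] at this; exact this.2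
  · have : j ∈ med x y z := Or.inr ⟨h2, h1⟩
    rw [h] at this; exact this.2

theorem med_swap (x y z : Set (Set V)) : med x y z = med y x z := by
  ext h; simp only [med, mem_union, mem_inter_iff]; tauto

theorem med_principal (hG : IsCCC G) {x y z : Set (Set V)} (hx : IsUltra G x) (hy : IsUltra G y)
    (hz : IsUltra G z) (v : V) (h1 : grom G v x y ≠ ⊤) (h2 : grom G v y z ≠ ⊤)
    (h3 : grom G v x z ≠ ⊤) : ∃ p, med x y z = princ G p := by
  unfold grom at *
  rw [encard_ne_top_iff] at *
  refine principal_of_finite hG (med_ultra hx hy hz) _ v ?_ rfl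
  refine ((h1.union h2).union h3).subset ?_
  rintro j ⟨((⟨a, b⟩ | ⟨a, b⟩) | ⟨a, b⟩), hv⟩
  · exact Or.inl (Or.inl ⟨a, b, hv⟩)
  · exact Or.inl (Or.inr ⟨a, b, hv⟩)
  · exact Or.inr ⟨b, a, hv⟩

/-- combinatorial form of being opposite -/
def Opp (x y : Set (Set V)) (m : V) : Prop :=
  ∀ h ∈ x, ∀ k ∈ y, m ∉ h → m ∉ k → ¬ (h ∩ k).Nonempty

theorem Opp.symm {x y : Set (Set V)} {m : V} (h : Opp x y m) : Opp y x m := by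
  intro a ha b hb h1 h2 h3
  rw [inter_comm] at h3
  exact h b hb a ha h2 h1 h3

theorem opp_of_op (hG : IsCCC G) {x y z : Set (Set V)} (hx : IsUltra G x) (hy : IsUltra G y)
    {m : V} (hm : med x y z = princ G m) (hop : Op G x y z) : Opp x y m := by
  rintro h hh k hk hmh hmk ⟨p, hph, hpk⟩
  obtain ⟨-, hop⟩ := hop
  rw [hm] at hop
  have hxy := grom_zero.1 (med_princ_grom hm).1
  have hmem : med x y (princ G p) ∈ rInterval G x y :=
    ⟨med_ultra hx hy (princ_ultra hG p), fun j hj => Or.inl (Or.inl hj)⟩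
  have hu := hmem.1
  rw [hop] at hmem
  have hhs := hx.1 h hh
  have hks := hy.1 k hk
  rcases hmem with ⟨-, hs⟩ | ⟨-, hs⟩
  · have h1 : k ∉ x := fun h' => hmk (hxy k h' hk)
    have h2 := hs ⟨ultra_compl hx hks h1, (⟨half_compl hG hks, hmk⟩ : kᶜ ∈ princ G m)⟩
    exact ultra_not hu h2 (Or.inl (Or.inr ⟨hk, hks, hpk⟩))
  · have h1 : h ∉ y := fun h' => hmh (hxy h hh h')
    have h2 := hs ⟨(⟨half_compl hG hhs, hmh⟩ : hᶜ ∈ princ G m), ultra_compl hy hhs h1⟩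
    exact ultra_not hu h2 (Or.inr ⟨⟨hhs, hph⟩, hh⟩)

end Ultra

section Rays

variable {V : Type*} {G : SimpleGraph V}

theorem step_exists (hG : IsCCC G) (hne : NoExtremal G) {v a : V} (h : G.Adj v a) :
    ∃ b, G.Adj a b ∧ edgeHalf G a b ⊆ edgeHalf G v a := by
  have := hne a
  unfold Extremal at this
  push Not at this
  obtain ⟨b, hb, hbv, hns⟩ := this v h.symm
  refine ⟨b, hb, fun w hw => ?_⟩
  by_contra hw'
  have hc := compl_edgeHalf hG h
  have hw2 : w ∈ edgeHalf G a v := by rw [← hc]; exact hw'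
  obtain ⟨c, h1, h2, h3⟩ := exists_square hG h.symm hb hbv.symm ⟨w, hw2, hw⟩
  exact hns ⟨c, h1, h2, h3⟩

/-- endpoints of straight rays -/
theorem straight_end (hG : IsCCC G) (hne : NoExtremal G) {v a : V} (h : G.Adj v a) :
    ∃ t, IsBdryPt G t ∧ edgeHalf G v a ∈ t ∧ ∀ j ∈ t, v ∉ j → j ⊆ edgeHalf G v a := by
  classical
  let E := {e : V × V // G.Adj e.1 e.2}
  have hstep : ∀ e : E, ∃ b, G.Adj e.1.2 b ∧ edgeHalf G e.1.2 b ⊆ edgeHalf G e.1.1 e.1.2 :=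
    fun e => step_exists hG hne e.2
  choose nx hnx1 hnx2 using hstep
  let e : ℕ → E := fun n => Nat.rec ⟨(v, a), h⟩ (fun _ e => ⟨(e.1.2, nx e), hnx1 e⟩) n
  let r : ℕ → V := fun n => (e n).1.1
  have hr1 : ∀ n, (e n).1.2 = r (n + 1) := fun n => rfl
  have hadj : ∀ n, G.Adj (r n) (r (n + 1)) := fun n => (e n).2
  have hsub1 : ∀ n, edgeHalf G (r (n + 1)) (r (n + 2)) ⊆ edgeHalf G (r n) (r (n + 1)) :=
    fun n => hnx2 (e n)
  have hr0 : r 0 = v := rfl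
  have hr1' : r 1 = a := rfl
  clear_value r
  clear hr1
  let H : ℕ → Set V := fun n => edgeHalf G (r n) (r (n + 1))
  have hanti : Antitone H := antitone_nat_of_succ_le hsub1
  have hin : ∀ i n, i < n → r n ∈ H i := by
    intro i n hin
    obtain ⟨k, rfl⟩ : ∃ k, n = k + 1 := ⟨n - 1, by omega⟩
    exact hanti (by omega : i ≤ k) (right_mem_edgeHalf (hadj k))
  have hout : ∀ i n, n ≤ i → r n ∉ H i := fun i n hni hmem =>
    left_notMem_edgeHalf (hanti hni hmem)
  have hHs : ∀ n, IsHalfspace G (H n) := fun n => half_edge (hadj n)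
  have hH0 : H 0 = edgeHalf G v a := by simp only [H]; rw [hr0, hr1']
  have hdich : ∀ j, IsHalfspace G j → r 0 ∉ j → (∀ n, r n ∉ j) ∨ ∃ n, j = H n := by
    intro j hj h0
    by_cases hall : ∀ n, r n ∉ j
    · exact Or.inl hall
    · right
      push Not at hall
      have hs := Nat.find_spec hall
      have hm := fun k => Nat.find_min hall (m := k)
      generalize Nat.find hall = N at hs hm
      obtain ⟨k, rfl⟩ : ∃ k, N = k + 1 := by
        cases N with
        | zero => exact absurd hs h0
        | succ k => exact ⟨k, rfl⟩
      exact ⟨k, half_eq hG hj (hadj k) (hm k (by omega)) hs⟩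
  have hHt : ∀ n, H n ∈ rayEnd G r := fun n => ⟨hHs n, n + 1, fun k hk => hin n k (by omega)⟩
  have hin_ex : ∀ j, IsHalfspace G j → r 0 ∉ j → j ∈ rayEnd G r ∨ jᶜ ∈ rayEnd G r := by
    intro j hj h0
    rcases hdich j hj h0 with h1 | ⟨n, rfl⟩
    · exact Or.inr ⟨half_compl hG hj, 0, fun n _ => h1 n⟩
    · exact Or.inl (hHt n)
  have hint : ∀ h ∈ rayEnd G r, ∀ k ∈ rayEnd G r, (h ∩ k).Nonempty := by
    rintro h ⟨-, N, hN⟩ k ⟨-, M, hM⟩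
    exact ⟨r (max N M), hN _ (le_max_left _ _), hM _ (le_max_right _ _)⟩
  have hU : IsUltra G (rayEnd G r) := by
    refine ⟨fun h hh => hh.1, fun h hh => ⟨fun h1 h2 => ?_, fun h1 => ?_⟩, hint⟩
    · obtain ⟨w, h3, h4⟩ := hint _ h1 _ h2
      exact h4 h3
    · by_cases h0 : r 0 ∈ h
      · have := hin_ex _ (half_compl hG hh) (fun hc => hc h0)
        rw [compl_compl] at this
        exact this.resolve_left h1
      · exact (hin_ex _ hh h0).resolve_right h1
  have hkey : ∀ j ∈ rayEnd G r, v ∉ j → j ⊆ edgeHalf G v a := by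
    intro j hj hvj
    rw [← hr0] at hvj
    rcases hdich j hj.1 hvj with h1 | ⟨n, rfl⟩
    · obtain ⟨-, N, hN⟩ := hj
      exact absurd (hN N le_rfl) (h1 N)
    · rw [← hH0]; exact hanti (Nat.zero_le n)
  refine ⟨rayEnd G r, ⟨hU, fun p hp => ?_⟩, hH0 ▸ hHt 0, hkey⟩
  have hf := finite_sep hG (r 0) p
  have hinj : Function.Injective H := by
    intro i k hik
    by_contra hne'
    rcases lt_or_gt_of_ne hne' with hlt | hlt
    · exact hout k k le_rfl (hik ▸ hin i k hlt)
    · exact hout i i le_rfl (hik ▸ hin k i hlt)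
  refine Set.infinite_range_of_injective hinj (hf.subset ?_)
  rintro _ ⟨n, rfl⟩
  have := hHt n
  rw [hp] at this
  exact ⟨hHs n, this.2, hout n 0 (Nat.zero_le _)⟩

/-- failure of oppositeness is witnessed by a boundary point -/
theorem not_opp_witness (hG : IsCCC G) (hne : NoExtremal G) {x y z : Set (Set V)}
    (hx : IsUltra G x) (hy : IsUltra G y) (hz : IsUltra G z) {m : V}
    (hm : med x y z = princ G m) (hn : ¬ Opp x y m) :
    ∃ t, IsBdryPt G t ∧ grom G m z t = 0 ∧ grom G m x t ≠ 0 ∧ grom G m y t ≠ 0 := by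
  unfold Opp at hn
  push Not at hn
  obtain ⟨h0, hh0, k0, hk0, hmh0, hmk0, p, hph, hpk⟩ := hn
  obtain ⟨hxy, hyz, hxz⟩ := med_princ_grom hm
  rw [grom_zero] at hxy hyz hxz
  obtain ⟨a, hma, hsa⟩ := exists_adjacent hG (hx.1 _ hh0) hmh0
  obtain ⟨b, hmb, hsb⟩ := exists_adjacent hG (hy.1 _ hk0) hmk0
  have hax := ultra_up hx hh0 (half_edge hma) hsa
  have hby := ultra_up hy hk0 (half_edge hmb) hsb
  have hab : a ≠ b := by
    rintro rfl
    exact left_notMem_edgeHalf (hxy _ hax hby)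
  obtain ⟨c, hcm, hac, hbc⟩ := exists_square hG hma hmb hab ⟨p, hsa hph, hsb hpk⟩
  have hsq : edgeHalf G m b = edgeHalf G a c :=
    square_eq hG hmb hma hbc hac hcm.symm hab.symm
  obtain ⟨t, ht, htm, htk⟩ := straight_end hG hne hac
  rw [← hsq] at htm htk
  have hht : edgeHalf G m a ∈ t := by
    by_contra hcon
    have h1 := ultra_compl ht.1 (half_edge hma) hcon
    have h2 := htk _ h1 (fun h => h (right_mem_edgeHalf hma))
    exact left_notMem_edgeHalf (h2 left_notMem_edgeHalf)
  refine ⟨t, ht, ?_, ?_, ?_⟩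
  · rw [grom_zero]
    intro j hjz hjt
    by_contra hmj
    by_cases haj : a ∈ j
    · have := half_eq hG (hz.1 _ hjz) hma hmj haj
      subst this
      exact hmj (hxz _ hax hjz)
    · have := ultra_up hz hjz (half_edge hmb) (htk j hjt haj)
      exact left_notMem_edgeHalf (hyz _ hby this)
  · rw [ne_eq, grom_zero]
    intro h; exact left_notMem_edgeHalf (h _ hax hht)
  · rw [ne_eq, grom_zero]
    intro h; exact left_notMem_edgeHalf (h _ hby htm)

/-- an auxiliary boundary point which is far from `x1`, `x`, `w` -/
theorem aux_point (hG : IsCCC G) (hne : NoExtremal G) {x1 x2 x w : Set (Set V)}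
    (h1 : IsUltra G x1) (h2 : IsUltra G x2) (hx : IsUltra G x) (hw : IsUltra G w) {m : V}
    (hm : med x1 x2 x = princ G m) (hop : Opp x1 x2 m)
    (hxw : grom G m x w ≠ 0) (h2w : grom G m x2 w ≠ 0) :
    ∃ t, ∃ b : V, IsBdryPt G t ∧ grom G b x1 t = 0 ∧ grom G b x t = 0 ∧ grom G b w t = 0 := by
  rw [ne_eq, grom_zero] at hxw h2w
  push Not at hxw h2w
  obtain ⟨h0, hh0x, hh0w, hmh0⟩ := hxw
  obtain ⟨k0, hk0x, hk0w, hmk0⟩ := h2w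
  obtain ⟨h12, h2x, h1x⟩ := med_princ_grom hm
  rw [grom_zero] at h12 h2x h1x
  obtain ⟨a, hma, hsa⟩ := exists_adjacent hG (hx.1 _ hh0x) hmh0
  obtain ⟨b, hmb, hsb⟩ := exists_adjacent hG (h2.1 _ hk0x) hmk0
  have hax := ultra_up hx hh0x (half_edge hma) hsa
  have haw := ultra_up hw hh0w (half_edge hma) hsa
  have hb2 := ultra_up h2 hk0x (half_edge hmb) hsb
  have hbw := ultra_up hw hk0w (half_edge hmb) hsb
  have hab : a ≠ b := by
    rintro rfl
    exact left_notMem_edgeHalf (h2x _ hb2 hax)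
  obtain ⟨c, hcm, hac, hbc⟩ := exists_square hG hma hmb hab (hw.2.2 _ haw _ hbw)
  have hsq : edgeHalf G m a = edgeHalf G b c :=
    square_eq hG hma hmb hac hbc hcm.symm hab
  have hak : a ∉ edgeHalf G m b := by
    have hsq2 : edgeHalf G m b = edgeHalf G a c :=
      square_eq hG hmb hma hbc hac hcm.symm hab.symm
    rw [hsq2]; exact left_notMem_edgeHalf
  have hnx := hne b
  unfold Extremal at hnx
  push Not at hnx
  obtain ⟨e, hbe, hec, hns⟩ := hnx c hbc
  have hdis : ¬ (edgeHalf G b c ∩ edgeHalf G b e).Nonempty := by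
    intro hi
    obtain ⟨c', q1, q2, q3⟩ := exists_square hG hbc hbe hec.symm hi
    exact hns ⟨c', q1, q2, q3⟩
  rw [← hsq] at hdis
  have hmj : m ∉ edgeHalf G b e := by
    intro hmj
    have := half_eq hG (half_edge hbe) hmb.symm left_notMem_edgeHalf hmj
    rw [← compl_edgeHalf hG hmb] at this
    rw [this] at hdis
    exact hdis ⟨a, right_mem_edgeHalf hma, hak⟩
  have hek : e ∈ edgeHalf G m b := by
    by_contra hek
    have := half_eq hG (half_compl hG (half_edge hmb)) hbe
      (fun h => h (right_mem_edgeHalf hmb)) hek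
    rw [← this] at hmj
    exact hmj left_notMem_edgeHalf
  have hj1 : edgeHalf G b e ∉ x1 := fun hj1 =>
    hop _ hj1 _ hb2 hmj left_notMem_edgeHalf ⟨e, right_mem_edgeHalf hbe, hek⟩
  have hjx : edgeHalf G b e ∉ x := fun hj => hdis (hx.2.2 _ hax _ hj)
  have hjw : edgeHalf G b e ∉ w := fun hj => hdis (hw.2.2 _ haw _ hj)
  obtain ⟨t, ht, -, htk⟩ := straight_end hG hne hbe
  have key : ∀ σ, IsUltra G σ → edgeHalf G b e ∉ σ → grom G b σ t = 0 := by
    intro σ hσ hn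
    rw [grom_zero]
    intro i hi hit
    by_contra hbi
    exact hn (ultra_up hσ hi (half_edge hbe) (htk i hit hbi))
  exact ⟨t, b, ht, key _ h1 hj1, key _ hx hjx, key _ hw hjw⟩

end Rays

section Cross

variable {V V' : Type*} {G : SimpleGraph V} {G' : SimpleGraph V'}

theorem toE_zero : toE 0 = 0 := by simp [toE]

theorem toE_top : toE ⊤ = ⊤ := by simp [toE]

theorem toE_nat (n : ℕ) : toE (n : ℕ∞) = ((n : ℝ) : EReal) := by
  unfold toE
  rw [ENat.toENNReal_coe, ← ENNReal.ofReal_natCast, EReal.coe_ennreal_ofReal,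
    max_eq_left (Nat.cast_nonneg n)]

theorem enat_add_top (a b : ℕ∞) : a + b = ⊤ ↔ a = ⊤ ∨ b = ⊤ := WithTop.add_eq_top

theorem toE_nonneg (n : ℕ∞) : 0 ≤ toE n := by
  unfold toE; exact EReal.coe_ennreal_nonneg _

theorem toE_inj {a b : ℕ∞} (h : toE a = toE b) : a = b := by
  unfold toE at h
  exact ENat.toENNReal_inj.1 (EReal.coe_ennreal_injective h)

theorem toE_eq_zero {a : ℕ∞} (h : toE a = 0) : a = 0 := toE_inj (h.trans toE_zero.symm)

theorem toE_neg {a b : ℕ∞} (h : toE a = - toE b) : a = 0 ∧ b = 0 := by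
  have h1 := toE_nonneg a
  have h2 := toE_nonneg b
  have h3 : toE b = 0 := by
    apply le_antisymm _ h2
    rw [h] at h1
    have := EReal.neg_le_neg_iff.2 h1
    simpa using this
  rw [h3, neg_zero] at h
  exact ⟨toE_eq_zero h, toE_eq_zero h3⟩

/-- differences of numbers one of which vanishes determine both numbers -/
theorem toE_sub_inj {a b a' b' : ℕ∞} (h : toE a - toE b = toE a' - toE b')
    (h1 : a = 0 ∨ b = 0) (h2 : a' = 0 ∨ b' = 0) : a = a' ∧ b = b' := by
  rcases h1 with rfl | rfl <;> rcases h2 with rfl | rfl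
  · simp only [toE_zero, zero_sub, neg_inj] at h
    exact ⟨rfl, toE_inj h⟩
  · simp only [toE_zero, zero_sub, sub_zero] at h
    have := toE_neg h.symm
    exact ⟨this.1.symm, this.2⟩
  · simp only [toE_zero, zero_sub, sub_zero] at h
    have := toE_neg h
    exact ⟨this.1, this.2.symm⟩
  · simp only [toE_zero, sub_zero] at h
    exact ⟨toE_inj h, rfl⟩

theorem toE_sub_cancel {a b c d : ℕ∞} (hc : c ≠ ⊤) (hd : d ≠ ⊤)
    (h : toE a - toE c - toE d = toE b - toE c - toE d) : a = b := by
  lift c to ℕ using hc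
  lift d to ℕ using hd
  rw [toE_nat, toE_nat] at h
  induction a using ENat.recTopCoe with
  | top =>
    induction b using ENat.recTopCoe with
    | top => rfl
    | coe b =>
      rw [toE_top, toE_nat, EReal.top_sub_coe, EReal.top_sub_coe, ← EReal.coe_sub,
        ← EReal.coe_sub] at h
      exact absurd h.symm (EReal.coe_ne_top _)
  | coe a =>
    induction b using ENat.recTopCoe with
    | top =>
      rw [toE_top, toE_nat, EReal.top_sub_coe, EReal.top_sub_coe, ← EReal.coe_sub,
        ← EReal.coe_sub] at h
      exact absurd h (EReal.coe_ne_top _)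
    | coe b =>
      rw [toE_nat, toE_nat, ← EReal.coe_sub, ← EReal.coe_sub, ← EReal.coe_sub,
        ← EReal.coe_sub, EReal.coe_eq_coe_iff] at h
      have : (a : ℝ) = b := by linarith
      exact_mod_cast this

theorem memA_swap23 {x y z w : Set (Set V)} (h : memA G x y z w) : memA G x z y w := by
  intro v
  have := h v
  simp only [inA, tripod] at *
  rw [grom_comm v z y]
  tauto

theorem memA_swap34 {x y z w : Set (Set V)} (h : memA G x y z w) : memA G x y w z := by
  intro v
  have := h v
  simp only [inA, tripod] at *
  rw [grom_comm v w z]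
  tauto

theorem memA_swap12 {x y z w : Set (Set V)} (h : memA G x y z w) : memA G y x z w := by
  intro v
  have := h v
  simp only [inA, tripod] at *
  rw [grom_comm v y x, add_comm (grom G v y z), add_comm (grom G v y w)]
  tauto

theorem mobius_fin (hG : IsCCC G) {f : Bdry G → Bdry G'} (hmob : Mobius G G' f)
    {x w : Bdry G} {v : V} (h : grom G v x.1 w.1 ≠ ⊤) (v' : V') :
    grom G' v' (f x).1 (f w).1 ≠ ⊤ := by
  have hA : memA G x.1 x.1 w.1 w.1 := by
    intro u
    have := grom_base hG x.2.1 u h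
    simp only [inA, tripod]
    right; right
    simp [this]
  have := (hmob _ _ _ _ hA).1 v'
  simp only [inA, tripod, ne_eq, enat_add_top, not_or] at this
  tauto

theorem opp_image (hG : IsCCC G) (hG' : IsCCC G') (hne : NoExtremal G)
    (f : Bdry G → Bdry G') (hmob : Mobius G G' f)
    (x1 x2 x w : Bdry G) {m : V} {m' : V'} (hm : med x1.1 x2.1 x.1 = princ G m)
    (hm' : med (f x1).1 (f x2).1 (f x).1 = princ G' m')
    (hop : Opp x1.1 x2.1 m) (h0 : grom G m x1.1 w.1 = 0)
    (hw0 : grom G' m' (f x).1 (f w).1 = 0)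
    (hw1 : grom G' m' (f x1).1 (f w).1 ≠ 0) : False := by
  obtain ⟨g12, g2x, g1x⟩ := med_princ_grom hm
  obtain ⟨g12', g2x', g1x'⟩ := med_princ_grom hm'
  by_cases hA : memA G x1.1 x2.1 x.1 w.1
  · have hc := (hmob _ _ _ _ (memA_swap23 hA)).2 m m'
    unfold crv at hc
    rw [g12, g12', h0, hw0, grom_comm m x.1 x2.1, g2x, grom_comm m' (f x).1 (f x2).1, g2x'] at hc
    simp only [toE_zero, zero_add, sub_zero, zero_sub] at hc
    exact hw1 (toE_neg hc.symm).2
  · have hinf : grom G m x.1 w.1 = ⊤ ∧ grom G m x2.1 w.1 = ⊤ := by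
      by_contra hcon
      apply hA
      intro v
      have b12 := grom_base hG x1.2.1 v (by rw [g12]; simp : grom G m x1.1 x2.1 ≠ ⊤)
      have b2x := grom_base hG x2.2.1 v (by rw [g2x]; simp : grom G m x2.1 x.1 ≠ ⊤)
      have b1x := grom_base hG x1.2.1 v (by rw [g1x]; simp : grom G m x1.1 x.1 ≠ ⊤)
      have b1w := grom_base hG x1.2.1 v (by rw [h0]; simp : grom G m x1.1 w.1 ≠ ⊤)
      simp only [inA, tripod, ne_eq, enat_add_top, not_or]
      by_cases hxw : grom G m x.1 w.1 = ⊤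
      · have h2w : grom G m x2.1 w.1 ≠ ⊤ := fun h => hcon ⟨hxw, h⟩
        exact Or.inr (Or.inr ⟨⟨b1x, grom_base hG x2.2.1 v h2w⟩, b1w, b2x⟩)
      · exact Or.inr (Or.inl ⟨⟨b12, grom_base hG x.2.1 v hxw⟩, b1w, b2x⟩)
    obtain ⟨t, b, ht, t1, tx, tw⟩ := aux_point hG hne x1.2.1 x2.2.1 x.2.1 w.2.1 hm hop
      (by rw [hinf.1]; simp) (by rw [hinf.2]; simp)
    let T : Bdry G := ⟨t, ht⟩
    have f1 : ∀ v, grom G v x1.1 t ≠ ⊤ := fun v => grom_base hG x1.2.1 v (by rw [t1]; simp)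
    have fx : ∀ v, grom G v x.1 t ≠ ⊤ := fun v => grom_base hG x.2.1 v (by rw [tx]; simp)
    have fw : ∀ v, grom G v w.1 t ≠ ⊤ := fun v => grom_base hG w.2.1 v (by rw [tw]; simp)
    have f1w : ∀ v, grom G v x1.1 w.1 ≠ ⊤ := fun v => grom_base hG x1.2.1 v (by rw [h0]; simp)
    have f1x : ∀ v, grom G v x1.1 x.1 ≠ ⊤ := fun v => grom_base hG x1.2.1 v (by rw [g1x]; simp)
    have hA' : memA G x.1 x1.1 w.1 T.1 := by
      intro v
      simp only [inA, tripod, ne_eq, enat_add_top, not_or]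
      rw [grom_comm v x.1 x1.1]
      exact Or.inr (Or.inl ⟨⟨f1x v, fw v⟩, fx v, f1w v⟩)
    have hc := (hmob x x1 w T hA').2 m m'
    unfold crv at hc
    rw [hinf.1, hw0, toE_top, toE_zero, zero_add, h0, toE_zero, sub_zero] at hc
    have e1 : grom G' m' (f x1).1 (f T).1 ≠ ⊤ := mobius_fin hG hmob (v := m) (f1 m) m'
    have e2 : grom G' m' (f x).1 (f T).1 ≠ ⊤ := mobius_fin hG hmob (v := m) (fx m) m'
    have e3 : grom G' m' (f x1).1 (f w).1 ≠ ⊤ := mobius_fin hG hmob (v := m) (f1w m) m'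
    have e4 : grom G m x1.1 T.1 ≠ ⊤ := f1 m
    have e5 : grom G m x.1 T.1 ≠ ⊤ := fx m
    obtain ⟨n1, hn1⟩ := ENat.ne_top_iff_exists.1 e1
    obtain ⟨n2, hn2⟩ := ENat.ne_top_iff_exists.1 e2
    obtain ⟨n3, hn3⟩ := ENat.ne_top_iff_exists.1 e3
    obtain ⟨n4, hn4⟩ := ENat.ne_top_iff_exists.1 e4
    obtain ⟨n5, hn5⟩ := ENat.ne_top_iff_exists.1 e5
    rw [← hn1, ← hn2, ← hn3, ← hn4, ← hn5, toE_nat, toE_nat, toE_nat, toE_nat, toE_nat,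
      EReal.top_add_coe, EReal.top_sub_coe, ← EReal.coe_sub, ← EReal.coe_sub] at hc
    exact EReal.coe_ne_top _ hc

theorem opp_zero {x1 x2 w : Set (Set V)} {m : V} (hw : IsUltra G w) (hop : Opp x1 x2 m) :
    grom G m x1 w = 0 ∨ grom G m x2 w = 0 := by
  by_contra hcon
  rw [not_or, grom_zero, grom_zero] at hcon
  push Not at hcon
  obtain ⟨⟨h, h1, h2, h3⟩, ⟨k, k1, k2, k3⟩⟩ := hcon
  exact hop h h1 k k1 h3 k3 (hw.2.2 _ h2 _ k2)

theorem opp_preserved (hG : IsCCC G) (hG' : IsCCC G') (hne : NoExtremal G)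
    (hne' : NoExtremal G')
    (f : Bdry G → Bdry G') (hbij : Function.Bijective f) (hmob : Mobius G G' f)
    (x1 x2 x : Bdry G) {m : V} {m' : V'} (hm : med x1.1 x2.1 x.1 = princ G m)
    (hm' : med (f x1).1 (f x2).1 (f x).1 = princ G' m')
    (hop : Opp x1.1 x2.1 m) : Opp (f x1).1 (f x2).1 m' := by
  by_contra hn
  obtain ⟨t, ht, h0, h1, h2⟩ := not_opp_witness hG' hne' (f x1).2.1 (f x2).2.1 (f x).2.1 hm' hn
  obtain ⟨w, hw⟩ := hbij.2 ⟨t, ht⟩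
  have hwt : (f w).1 = t := by rw [hw]
  rw [← hwt] at h0 h1 h2
  rcases opp_zero w.2.1 hop with h | h
  · exact opp_image hG hG' hne f hmob x1 x2 x w hm hm' hop h h0 h1
  · refine opp_image hG hG' hne f hmob x2 x1 x w ?_ ?_ hop.symm h h0 h2
    · rw [med_swap]; exact hm
    · rw [med_swap]; exact hm'

theorem med_exists_image (hG : IsCCC G) (hG' : IsCCC G')
    (f : Bdry G → Bdry G') (hmob : Mobius G G' f)
    (x1 x2 x : Bdry G) {m : V} (hm : med x1.1 x2.1 x.1 = princ G m) :
    ∃ p' : V', med (f x1).1 (f x2).1 (f x).1 = princ G' p' := by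
  obtain ⟨g12, g2x, g1x⟩ := med_princ_grom hm
  obtain ⟨v'⟩ := hG'.1.nonempty
  refine med_principal hG' (f x1).2.1 (f x2).2.1 (f x).2.1 v' ?_ ?_ ?_
  · exact mobius_fin hG hmob (v := m) (by rw [g12]; simp) v'
  · exact mobius_fin hG hmob (v := m) (by rw [g2x]; simp) v'
  · exact mobius_fin hG hmob (v := m) (by rw [g1x]; simp) v'

/-- Gromov products based at the median are preserved -/
theorem grom_preserved
    (f : Bdry G → Bdry G') (hmob : Mobius G G' f)
    (x1 x2 x u v : Bdry G) {m : V} {m' : V'} (hm : med x1.1 x2.1 x.1 = princ G m)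
    (hm' : med (f x1).1 (f x2).1 (f x).1 = princ G' m')
    (hop : Opp x1.1 x2.1 m) (hop' : Opp (f x1).1 (f x2).1 m')
    (hfin : grom G m u.1 v.1 ≠ ⊤)
    (hA : memA G x1.1 x2.1 u.1 v.1) (hu : memA G x1.1 x2.1 x.1 u.1)
    (hv : memA G x1.1 x2.1 x.1 v.1) :
    grom G m u.1 v.1 = grom G' m' (f u).1 (f v).1 := by
  obtain ⟨g12, g2x, g1x⟩ := med_princ_grom hm
  obtain ⟨g12', g2x', g1x'⟩ := med_princ_grom hm'
  have key : ∀ s : Bdry G, memA G x1.1 x2.1 x.1 s.1 →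
      grom G m x1.1 s.1 = grom G' m' (f x1).1 (f s).1 ∧
      grom G m x2.1 s.1 = grom G' m' (f x2).1 (f s).1 := by
    intro s hs
    have hc := (hmob _ _ _ _ hs).2 m m'
    unfold crv at hc
    rw [g1x, g1x', g2x, g2x'] at hc
    simp only [toE_zero, zero_add, sub_zero] at hc
    have := toE_sub_inj hc.symm (opp_zero s.2.1 hop).symm (opp_zero (f s).2.1 hop').symm
    exact ⟨this.2, this.1⟩
  have ku := key u hu
  have kv := key v hv
  have hAm := hA m
  simp only [inA, tripod, ne_eq, enat_add_top, not_or] at hAm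
  have hAm2 : (grom G m x1.1 u.1 ≠ ⊤ ∧ grom G m x2.1 v.1 ≠ ⊤) ∨
      (grom G m x1.1 v.1 ≠ ⊤ ∧ grom G m x2.1 u.1 ≠ ⊤) := by
    rcases hAm with h | h | h
    exacts [Or.inl h.2, Or.inr h.2, Or.inl h.1]
  have main : ∀ s r : Bdry G, memA G x1.1 x2.1 s.1 r.1 →
      grom G m x1.1 r.1 = grom G' m' (f x1).1 (f r).1 →
      grom G m x2.1 s.1 = grom G' m' (f x2).1 (f s).1 →
      grom G m x1.1 r.1 ≠ ⊤ → grom G m x2.1 s.1 ≠ ⊤ →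
      grom G m s.1 r.1 = grom G' m' (f s).1 (f r).1 := by
    intro s r hsr e1 e2 n1 n2
    have hc := (hmob _ _ _ _ (memA_swap23 hsr)).2 m m'
    unfold crv at hc
    rw [g12, g12', grom_comm m s.1 x2.1, grom_comm m' (f s).1 (f x2).1, ← e1, ← e2] at hc
    simp only [toE_zero, zero_add] at hc
    exact (toE_sub_cancel n1 n2 hc).symm
  by_cases hcase : grom G m x1.1 v.1 ≠ ⊤ ∧ grom G m x2.1 u.1 ≠ ⊤
  · exact main u v hA kv.1 ku.2 hcase.1 hcase.2
  · rw [grom_comm m u.1 v.1, grom_comm m' (f u).1 (f v).1]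
    have : grom G m x1.1 u.1 ≠ ⊤ ∧ grom G m x2.1 v.1 ≠ ⊤ := hAm2.resolve_right hcase
    exact main v u (memA_swap34 hA) ku.1 kv.2 this.1 this.2

theorem dist_half (hG : IsCCC G) {y1 y2 y : Set (Set V)} (h1 : IsUltra G y1)
    (h2 : IsUltra G y2) {n : V}
    (m : V) (hn : med y1 y2 y = princ G n) (h0 : grom G n y2 (princ G m) = 0) :
    (G.dist m n : ℕ∞) + grom G m y1 y = grom G m y1 y2 + grom G m y2 y ∧
      grom G m y1 y ≤ grom G m y2 y := by
  rw [grom_zero] at h0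
  have hsub : ∀ h ∈ y1, h ∈ y → m ∉ h → h ∈ y2 := by
    intro h a b c
    by_contra d
    have hh := h1.1 h a
    have d' := ultra_compl h2 hh d
    have := h0 _ d' ⟨half_compl hG hh, c⟩
    have hp : h ∈ princ G n := by rw [← hn]; exact Or.inr ⟨b, a⟩
    exact this hp.2
  have hsep := encard_sep hG _ (rfl : G.dist m n = G.dist m n)
  have hU : {h : Set V | IsHalfspace G h ∧ n ∈ h ∧ m ∉ h} =
      {h | h ∈ y1 ∧ h ∈ y2 ∧ m ∉ h} ∪ {h | h ∈ y2 ∧ h ∈ y ∧ m ∉ h} := by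
    ext h
    have hiff : IsHalfspace G h ∧ n ∈ h ↔ h ∈ med y1 y2 y := by rw [hn]; rfl
    have := hsub h
    simp only [mem_union, mem_ofPred_eq]
    rw [← and_assoc, hiff]
    simp only [med, mem_union, mem_inter_iff]
    tauto
  have hI : {h : Set V | h ∈ y1 ∧ h ∈ y ∧ m ∉ h} =
      {h | h ∈ y1 ∧ h ∈ y2 ∧ m ∉ h} ∩ {h | h ∈ y2 ∧ h ∈ y ∧ m ∉ h} := by
    ext h
    have := hsub h
    simp only [mem_inter_iff, mem_ofPred_eq]
    tauto
  unfold grom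
  constructor
  · rw [← hsep, hU, hI]
    exact encard_union_add_encard_inter _ _
  · rw [hI]; exact encard_le_encard inter_subset_right

theorem dist_formula (hG : IsCCC G) {y1 y2 y : Set (Set V)} (h1 : IsUltra G y1)
    (h2 : IsUltra G y2) {n : V}
    (m : V) (hn : med y1 y2 y = princ G n) (hop : Opp y1 y2 n) :
    ((G.dist m n : ℕ∞) + grom G m y1 y = grom G m y1 y2 + grom G m y2 y ∧
      grom G m y1 y ≤ grom G m y2 y) ∨
    ((G.dist m n : ℕ∞) + grom G m y2 y = grom G m y1 y2 + grom G m y1 y ∧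
      grom G m y2 y ≤ grom G m y1 y) := by
  rcases opp_zero (princ_ultra hG m) hop with h | h
  · right
    rw [grom_comm m y1 y2]
    exact dist_half hG h2 h1 m (by rw [med_swap]; exact hn) h
  · left
    exact dist_half hG h1 h2 m hn h

theorem fin_ne (hG : IsCCC G) {x y : Bdry G} {v : V} (h : grom G v x.1 y.1 = 0) : x ≠ y := by
  rintro rfl
  rw [grom_self hG x.2] at h
  simp at h

theorem enat_arith {d d' : ℕ} {a b c : ℕ∞} (ha : a ≠ ⊤) (hb : b ≠ ⊤) (hc : c ≠ ⊤)
    (h1 : ((d : ℕ∞) + b = a + c ∧ b ≤ c) ∨ ((d : ℕ∞) + c = a + b ∧ c ≤ b))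
    (h2 : ((d' : ℕ∞) + b = a + c ∧ b ≤ c) ∨ ((d' : ℕ∞) + c = a + b ∧ c ≤ b)) : d = d' := by
  lift a to ℕ using ha
  lift b to ℕ using hb
  lift c to ℕ using hc
  norm_cast at h1 h2
  omega

end Cross

end CCCR

open CCCR
/-- Corollary `distance is preserved`: under the stated
𝒜-membership hypotheses, the distance between the medians is preserved by a
Möbius bijection; in particular `m'_x = m'_y` if and only if `m_x = m_y`. -/
theorem stmt11 {V V' : Type*} (G : SimpleGraph V) (G' : SimpleGraph V')
    (hG : IsCCC G) (hG' : IsCCC G') (hne : NoExtremal G) (hne' : NoExtremal G')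
    (f : Bdry G → Bdry G') (hbij : Function.Bijective f) (hmob : Mobius G G' f)
    (x1 x2 x y1 y2 y : Bdry G)
    (hopx : Op G x1.1 x2.1 x.1) (hopy : Op G y1.1 y2.1 y.1)
    (hA : ∀ u v : Bdry G, u ∈ ({y1, y2, y} : Set (Bdry G)) →
      v ∈ ({y1, y2, y} : Set (Bdry G)) → u ≠ v →
      memA G x1.1 x2.1 u.1 v.1 ∧ memA G x1.1 x2.1 x.1 u.1) :
    (∃ p' : V', med (f x1).1 (f x2).1 (f x).1 = princ G' p') ∧
    (∃ q' : V', med (f y1).1 (f y2).1 (f y).1 = princ G' q') ∧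
    (∀ (p q : V) (p' q' : V'),
      med x1.1 x2.1 x.1 = princ G p → med y1.1 y2.1 y.1 = princ G q →
      med (f x1).1 (f x2).1 (f x).1 = princ G' p' →
      med (f y1).1 (f y2).1 (f y).1 = princ G' q' →
      G.dist p q = G'.dist p' q') ∧
    (med (f x1).1 (f x2).1 (f x).1 = med (f y1).1 (f y2).1 (f y).1 ↔
      med x1.1 x2.1 x.1 = med y1.1 y2.1 y.1) := by
  obtain ⟨⟨p, hp⟩, -⟩ := id hopx
  obtain ⟨⟨q, hq⟩, -⟩ := id hopy
  obtain ⟨p', hp'⟩ := med_exists_image hG hG' f hmob x1 x2 x hp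
  obtain ⟨q', hq'⟩ := med_exists_image hG hG' f hmob y1 y2 y hq
  have hdist : G.dist p q = G'.dist p' q' := by
    have ox := opp_of_op hG x1.2.1 x2.2.1 hp hopx
    have oy := opp_of_op hG y1.2.1 y2.2.1 hq hopy
    have ox' := opp_preserved hG hG' hne hne' f hbij hmob x1 x2 x hp hp' ox
    have oy' := opp_preserved hG hG' hne hne' f hbij hmob y1 y2 y hq hq' oy
    obtain ⟨g12, g2y, g1y⟩ := med_princ_grom hq
    have m1 : y1 ∈ ({y1, y2, y} : Set (Bdry G)) := by simp
    have m2 : y2 ∈ ({y1, y2, y} : Set (Bdry G)) := by simp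
    have m3 : y ∈ ({y1, y2, y} : Set (Bdry G)) := by simp
    have n12 := hA y1 y2 m1 m2 (fin_ne hG g12)
    have n2y := hA y2 y m2 m3 (fin_ne hG g2y)
    have n1y := hA y1 y m1 m3 (fin_ne hG g1y)
    have nyy := hA y y1 m3 m1 (fin_ne hG g1y).symm
    have f12 := grom_base hG y1.2.1 p (by rw [g12]; simp : grom G q y1.1 y2.1 ≠ ⊤)
    have f2y := grom_base hG y2.2.1 p (by rw [g2y]; simp : grom G q y2.1 y.1 ≠ ⊤)
    have f1y := grom_base hG y1.2.1 p (by rw [g1y]; simp : grom G q y1.1 y.1 ≠ ⊤)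
    have e12 := grom_preserved f hmob x1 x2 x y1 y2 hp hp' ox ox' f12 n12.1 n12.2 n2y.2
    have e2y := grom_preserved f hmob x1 x2 x y2 y hp hp' ox ox' f2y n2y.1 n2y.2 nyy.2
    have e1y := grom_preserved f hmob x1 x2 x y1 y hp hp' ox ox' f1y n1y.1 n1y.2 nyy.2
    have d1 := dist_formula hG y1.2.1 y2.2.1 p hq oy
    have d2 := dist_formula hG' (f y1).2.1 (f y2).2.1 p' hq' oy'
    rw [← e12, ← e2y, ← e1y] at d2
    exact enat_arith f12 f1y f2y d1 d2
  refine ⟨⟨p', hp'⟩, ⟨q', hq'⟩, ?_, ?_⟩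
  · intro a b a' b' ha hb ha' hb'
    rw [princ_inj hG (ha.symm.trans hp), princ_inj hG (hb.symm.trans hq),
      princ_inj hG' (ha'.symm.trans hp'), princ_inj hG' (hb'.symm.trans hq')]
    exact hdist
  · rw [hp, hq, hp', hq']
    constructor
    · intro h
      have h1 := princ_inj hG' h
      rw [h1, SimpleGraph.dist_self] at hdist
      rw [hG.1.dist_eq_zero_iff.1 hdist]
    · intro h
      have h1 := princ_inj hG h
      rw [h1, SimpleGraph.dist_self] at hdist
      rw [hG'.1.dist_eq_zero_iff.1 hdist.symm]
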